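/- Define a 2-criterion set to be a finite set 𝒮 of positive-definite binary integer-matrix forms such that every positive-definite integer-matrix form (of any rank) representing all members of 𝒮 is 2-universal (represents every positive-definite binary integer-matrix form). Assuming the Kim–Kim–Oh theorem that 𝒮₂ = {⟨1,1⟩, ⟨2,3⟩, ⟨3,3⟩, [2,1,2], [2,1,3], [2,1,4]} is a 2-criterion set, prove: every 2-criterion set 𝒮 contains all six forms of 𝒮₂ (up to equivalence). -/

import Mathlib

open Matrix

/-- `G` (Gram matrix of a `ℤ`-lattice) represents the quadratic form with Gram matrix `q`:
there is a `ℤ`-linear injection preserving the bilinear forms. -/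
def Represents {ι κ : Type*} [Fintype ι] [Fintype κ]
    (G : Matrix ι ι ℤ) (q : Matrix κ κ ℤ) : Prop :=
  ∃ S : Matrix ι κ ℤ, Function.Injective S.mulVec ∧ Sᵀ * G * S = q

/-- A symmetric positive-definite integer Gram matrix. -/
def IsPosDefForm {ι : Type*} [Fintype ι] (G : Matrix ι ι ℤ) : Prop :=
  G.IsSymm ∧ ∀ x : ι → ℤ, x ≠ 0 → 0 < x ⬝ᵥ G.mulVec x

/-- The binary form `[a,b,c] = a x² + 2 b x y + c y²` with Gram matrix `((a,b),(b,c))`. -/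
def bin (a b c : ℤ) : Matrix (Fin 2) (Fin 2) ℤ := !![a, b; b, c]


/-- Two binary forms are equivalent if their Gram matrices are `GL₂(ℤ)`-equivalent. -/
def EquivForm (q q' : Matrix (Fin 2) (Fin 2) ℤ) : Prop :=
  ∃ U : Matrix (Fin 2) (Fin 2) ℤ, IsUnit U.det ∧ Uᵀ * q * U = q'

/-- A 2-criterion set: a finite set `S` of positive-definite binary integer-matrix forms
such that every positive-definite integer-matrix form representing all of `S` is
2-universal. -/
def IsCriterionSet (S : Finset (Matrix (Fin 2) (Fin 2) ℤ)) : Prop :=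
  (∀ q ∈ S, IsPosDefForm q) ∧
  ∀ (n : ℕ) (G : Matrix (Fin n) (Fin n) ℤ), IsPosDefForm G →
    (∀ q ∈ S, Represents G q) →
    ∀ q : Matrix (Fin 2) (Fin 2) ℤ, IsPosDefForm q → Represents G q

section Auxiliary

variable {ι κ : Type*} [Fintype ι] [Fintype κ]

theorem injective_mulVec_of_transpose_mul_mul {G : Matrix ι ι ℤ} {q : Matrix κ κ ℤ}
    (hq : IsPosDefForm q) {T : Matrix ι κ ℤ} (hT : Tᵀ * G * T = q) :
    Function.Injective T.mulVec := by
  intro x y hxy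
  by_contra hne
  have h := hq.2 (x - y) (sub_ne_zero.2 hne)
  have hz : T *ᵥ (x - y) = 0 := by rw [mulVec_sub, sub_eq_zero]; exact hxy
  rw [← hT, ← mulVec_mulVec, hz, mulVec_zero, dotProduct_zero] at h
  exact lt_irrefl _ h

theorem IsPosDefForm.equivForm {q q' : Matrix (Fin 2) (Fin 2) ℤ} (hq : IsPosDefForm q)
    (h : EquivForm q q') : IsPosDefForm q' := by
  obtain ⟨U, hU, rfl⟩ := h
  refine ⟨?_, fun x hx => ?_⟩
  · simp [IsSymm, transpose_mul, hq.1.eq, Matrix.mul_assoc]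
  · have hUx : U *ᵥ x ≠ 0 := by
      intro h0
      apply hx
      rw [← one_mulVec x, ← nonsing_inv_mul U hU, ← mulVec_mulVec, h0, mulVec_zero]
    have := hq.2 _ hUx
    rwa [← mulVec_mulVec, ← mulVec_mulVec, dotProduct_mulVec, vecMul_transpose]

theorem EquivForm.refl (q : Matrix (Fin 2) (Fin 2) ℤ) : EquivForm q q := ⟨1, by simp, by simp⟩

theorem EquivForm.symm {q q' : Matrix (Fin 2) (Fin 2) ℤ} (h : EquivForm q q') :
    EquivForm q' q := by
  obtain ⟨U, hU, rfl⟩ := h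
  have h1 : U * U⁻¹ = 1 := mul_nonsing_inv U hU
  have h2 : (U⁻¹)ᵀ * Uᵀ = 1 := by rw [← transpose_mul, h1, transpose_one]
  refine ⟨U⁻¹, isUnit_nonsing_inv_det U hU, ?_⟩
  calc (U⁻¹)ᵀ * (Uᵀ * q * U) * U⁻¹ = ((U⁻¹)ᵀ * Uᵀ) * q * (U * U⁻¹) := by
        simp only [Matrix.mul_assoc]
    _ = q := by rw [h1, h2, Matrix.one_mul, Matrix.mul_one]

theorem EquivForm.trans {q q' q'' : Matrix (Fin 2) (Fin 2) ℤ} (h : EquivForm q q')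
    (h' : EquivForm q' q'') : EquivForm q q'' := by
  obtain ⟨U, hU, rfl⟩ := h
  obtain ⟨V, hV, rfl⟩ := h'
  exact ⟨U * V, by rw [det_mul]; exact hU.mul hV, by simp [transpose_mul, Matrix.mul_assoc]⟩

theorem Represents.equivForm {G : Matrix ι ι ℤ} {q q' : Matrix (Fin 2) (Fin 2) ℤ}
    (hq : IsPosDefForm q) (h : Represents G q) (h' : EquivForm q q') : Represents G q' := by
  have hq' := hq.equivForm h'
  obtain ⟨T, -, hT⟩ := h
  obtain ⟨U, -, hU⟩ := h'
  have key : (T * U)ᵀ * G * (T * U) = q' := by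
    rw [← hU, ← hT]; simp [transpose_mul, Matrix.mul_assoc]
  exact ⟨T * U, injective_mulVec_of_transpose_mul_mul hq' key, key⟩

theorem represents_bin_iff {G : Matrix ι ι ℤ} (hG : G.IsSymm) {a b c : ℤ}
    (hq : IsPosDefForm (bin a b c)) :
    Represents G (bin a b c) ↔
      ∃ u v : ι → ℤ, u ⬝ᵥ G *ᵥ u = a ∧ u ⬝ᵥ G *ᵥ v = b ∧ v ⬝ᵥ G *ᵥ v = c := by
  have entry (T : Matrix ι (Fin 2) ℤ) (i j : Fin 2) :
      (Tᵀ * G * T) i j = Tᵀ i ⬝ᵥ G *ᵥ Tᵀ j := by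
    rw [Matrix.mul_assoc]; rfl
  constructor
  · rintro ⟨T, -, hT⟩
    refine ⟨Tᵀ 0, Tᵀ 1, ?_, ?_, ?_⟩ <;> rw [← entry, hT] <;> rfl
  · rintro ⟨u, v, huu, huv, hvv⟩
    have hvu : v ⬝ᵥ G *ᵥ u = b := by
      rw [← huv, dotProduct_mulVec, dotProduct_comm, ← mulVec_transpose, hG.eq]
    have key : (of ![u, v])ᵀᵀ * G * (of ![u, v])ᵀ = bin a b c := by
      ext i j
      have := entry (of ![u, v])ᵀ i j
      rw [this]
      fin_cases i <;> fin_cases j <;> simpa [bin]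
    exact ⟨_, injective_mulVec_of_transpose_mul_mul hq key, key⟩

theorem IsPosDefForm.eq_bin {q : Matrix (Fin 2) (Fin 2) ℤ} (hq : IsPosDefForm q) :
    q = bin (q 0 0) (q 0 1) (q 1 1) := by
  have := hq.1.apply 0 1
  ext i j; fin_cases i <;> fin_cases j <;> simp [bin, this]

theorem bin_form (a b c : ℤ) (x y : Fin 2 → ℤ) :
    x ⬝ᵥ bin a b c *ᵥ y = a * x 0 * y 0 + b * (x 0 * y 1 + x 1 * y 0) + c * x 1 * y 1 := by
  simp [bin, mulVec, dotProduct, Fin.sum_univ_two]; ring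

theorem bin_isSymm (a b c : ℤ) : (bin a b c).IsSymm := by
  ext i j; fin_cases i <;> fin_cases j <;> rfl

/-- A reduced form takes no nonzero value below its first coefficient. -/
theorem le_bin_form {a b c : ℤ} (hb : 0 ≤ b) (hba : 2 * b ≤ a) (hac : a ≤ c)
    {x : Fin 2 → ℤ} (hx : x ≠ 0) : a ≤ x ⬝ᵥ bin a b c *ᵥ x := by
  rw [bin_form]
  have hne : x 0 ≠ 0 ∨ x 1 ≠ 0 := by
    by_contra! h
    exact hx (by ext i; fin_cases i <;> simp [h.1, h.2])
  generalize x 0 = s at *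
  generalize x 1 = t at *
  have h1 : 1 ≤ s ^ 2 + t ^ 2 + s * t := by
    rcases hne with h | h
    · have : 1 ≤ s ^ 2 := by have := sq_pos_of_ne_zero h; omega
      nlinarith [sq_nonneg (s + 2 * t)]
    · have : 1 ≤ t ^ 2 := by have := sq_pos_of_ne_zero h; omega
      nlinarith [sq_nonneg (t + 2 * s)]
  have h2 : 1 ≤ s ^ 2 + t ^ 2 := by
    rcases hne with h | h
    · have := sq_pos_of_ne_zero h; nlinarith [sq_nonneg t]
    · have := sq_pos_of_ne_zero h; nlinarith [sq_nonneg s]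
  have h3 : 0 ≤ (c - a) * t ^ 2 := mul_nonneg (by linarith) (sq_nonneg t)
  nlinarith [mul_nonneg (sub_nonneg.2 hba) (sub_nonneg.2 h2), mul_nonneg hb (sub_nonneg.2 h1)]

theorem exists_equivForm_reduced {q : Matrix (Fin 2) (Fin 2) ℤ} (hq : IsPosDefForm q) :
    ∃ a b c : ℤ, 0 < a ∧ 0 ≤ b ∧ 2 * b ≤ a ∧ a ≤ c ∧ EquivForm (bin a b c) q := by
  have diag_pos {a b c : ℤ} (h : IsPosDefForm (bin a b c)) : 0 < a ∧ 0 < c := by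
    have h0 := h.2 ![1, 0] (by simp)
    have h1 := h.2 ![0, 1] (by simp)
    rw [bin_form] at h0 h1
    constructor
    · simpa using h0
    · simpa using h1
  have change (a b c s t u v : ℤ) (hdet : IsUnit (s * v - t * u)) :
      EquivForm (bin a b c) (bin (a * s * s + b * (s * u + u * s) + c * u * u)
        (a * s * t + b * (s * v + u * t) + c * u * v)
        (a * t * t + b * (t * v + v * t) + c * v * v)) := by
    refine ⟨!![s, t; u, v], by rwa [det_fin_two_of], ?_⟩
    ext i j
    fin_cases i <;> fin_cases j <;>
      simp [bin, Matrix.mul_apply, Fin.sum_univ_two] <;> ring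
  obtain ⟨n, hn⟩ : ∃ n : ℕ, ∃ a b c : ℤ, EquivForm q (bin a b c) ∧ a + c = n := by
    obtain ⟨h0, h1⟩ := diag_pos (hq.eq_bin ▸ hq)
    refine ⟨(q 0 0 + q 1 1).toNat, q 0 0, q 0 1, q 1 1, ?_, by omega⟩
    rw [← hq.eq_bin]; exact EquivForm.refl q
  classical
  have hex : ∃ n : ℕ, ∃ a b c : ℤ, EquivForm q (bin a b c) ∧ a + c = n := ⟨n, hn⟩
  obtain ⟨a, b, c, he, hsum⟩ := Nat.find_spec hex
  have hmin (a' b' c' : ℤ) (h : EquivForm (bin a b c) (bin a' b' c')) : a + c ≤ a' + c' := by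
    have h' := he.trans h
    obtain ⟨h0, h1⟩ := diag_pos (hq.equivForm h')
    have := Nat.find_min' hex ⟨a', b', c', h', (Int.toNat_of_nonneg (by omega)).symm⟩
    omega
  obtain ⟨ha, hc⟩ := diag_pos (hq.equivForm he)
  have h1 := hmin _ _ _ (change a b c 1 1 0 1 (by simp))
  have h2 := hmin _ _ _ (change a b c 1 (-1) 0 1 (by simp))
  have h3 := hmin _ _ _ (change a b c 1 0 1 1 (by simp))
  have h4 := hmin _ _ _ (change a b c 1 0 (-1) 1 (by simp))
  ring_nf at h1 h2 h3 h4
  have hflip : ∃ b', 0 ≤ b' ∧ 2 * b' ≤ a ∧ 2 * b' ≤ c ∧ EquivForm q (bin a b' c) := by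
    rcases le_total 0 b with hb | hb
    · exact ⟨b, hb, by linarith, by linarith, he⟩
    · refine ⟨-b, by linarith, by linarith, by linarith, he.trans ?_⟩
      simpa using change a b c 1 0 0 (-1) (by simp)
  obtain ⟨b', hb, hba, hbc, he'⟩ := hflip
  rcases le_total a c with hac | hac
  · exact ⟨a, b', c, ha, hb, hba, hac, he'.symm⟩
  · refine ⟨c, b', a, hc, hb, hbc, hac, (he'.trans ?_).symm⟩
    simpa using change a b' c 0 1 1 0 (by simp)

theorem fromBlocks_form (K : Matrix ι ι ℤ) (N : Matrix κ κ ℤ) (x y : ι ⊕ κ → ℤ) :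
    x ⬝ᵥ fromBlocks K 0 0 N *ᵥ y =
      (x ∘ Sum.inl) ⬝ᵥ K *ᵥ (y ∘ Sum.inl) + (x ∘ Sum.inr) ⬝ᵥ N *ᵥ (y ∘ Sum.inr) := by
  rw [fromBlocks_mulVec]
  simp [dotProduct, Fintype.sum_sum_type]

theorem blockDiagonal_form [DecidableEq κ] (N : κ → Matrix ι ι ℤ) (x y : ι × κ → ℤ) :
    x ⬝ᵥ blockDiagonal N *ᵥ y =
      ∑ k, (fun i => x (i, k)) ⬝ᵥ N k *ᵥ (fun i => y (i, k)) := by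
  simp only [dotProduct, mulVec, Fintype.sum_prod_type, blockDiagonal_apply, ite_mul, zero_mul,
    Finset.sum_ite_eq, Finset.mem_univ, if_true]
  rw [Finset.sum_comm]

theorem Represents.submatrix_equiv (e : ι ≃ κ) {G : Matrix ι ι ℤ}
    {q : Matrix (Fin 2) (Fin 2) ℤ} (hq : IsPosDefForm q) (h : Represents G q) :
    Represents (G.submatrix e.symm e.symm) q := by
  obtain ⟨T, -, hT⟩ := h
  have key : (T.submatrix e.symm id)ᵀ * G.submatrix e.symm e.symm * T.submatrix e.symm id = q := by
    rw [transpose_submatrix, submatrix_mul_equiv, submatrix_mul_equiv, hT, submatrix_id_id]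
  exact ⟨_, injective_mulVec_of_transpose_mul_mul hq key, key⟩

theorem IsCriterionSet.represents {S : Finset (Matrix (Fin 2) (Fin 2) ℤ)} (hS : IsCriterionSet S)
    {G : Matrix ι ι ℤ} (hG : IsPosDefForm G) (hrep : ∀ q ∈ S, Represents G q)
    {q : Matrix (Fin 2) (Fin 2) ℤ} (hq : IsPosDefForm q) : Represents G q := by
  let e := Fintype.equivFin ι
  have hpos : IsPosDefForm (G.submatrix e.symm e.symm) := by
    refine ⟨hG.1.submatrix _, fun x hx => ?_⟩
    have hne : x ∘ e ≠ 0 := fun h => hx <| by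
      ext i; simpa using congrFun h (e.symm i)
    have := hG.2 _ hne
    rw [submatrix_mulVec_equiv, Equiv.symm_symm]
    convert this using 1
    rw [← comp_equiv_dotProduct_comp_equiv _ _ e]
    congr 1
    ext i; simp
  have hall (p) (hp : p ∈ S) : Represents (G.submatrix e.symm e.symm) p :=
    (hrep p hp).submatrix_equiv e (hS.1 p hp)
  simpa using (hS.2 _ _ hpos hall q hq).submatrix_equiv e.symm hq

end Auxiliary

section Construction

variable {ι : Type*} [Fintype ι]

theorem form_of_support (N : Matrix ι ι ℤ) {κ : Type*} [Fintype κ] [DecidableEq κ]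
    (F : κ → Matrix ι ι ℤ) (k : κ) (hF : F k = N) (x y : ι → ℤ) :
    (fun p : ι × κ => if p.2 = k then x p.1 else 0) ⬝ᵥ
      blockDiagonal F *ᵥ (fun p => if p.2 = k then y p.1 else 0) = x ⬝ᵥ N *ᵥ y := by
  rw [blockDiagonal_form, Finset.sum_eq_single k]
  · simp [hF]
  · intro j _ hj
    simp [hj, dotProduct]
  · simp

/-- A finite set of forms, each represented by `K ⊥ N` for some binary `N` of minimum at
least `m`, is represented by a single `K ⊥ M` with `M` of minimum at least `m`. -/
theorem exists_common_orthogonal_sum {K : Matrix ι ι ℤ} (hK : IsPosDefForm K) {m : ℤ} (hm : 0 < m)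
    {S : Finset (Matrix (Fin 2) (Fin 2) ℤ)} (hS : ∀ q ∈ S, IsPosDefForm q)
    (hN : ∀ q ∈ S, ∃ N : Matrix (Fin 2) (Fin 2) ℤ, N.IsSymm ∧
      (∀ x : Fin 2 → ℤ, x ≠ 0 → m ≤ x ⬝ᵥ N *ᵥ x) ∧ Represents (fromBlocks K 0 0 N) q) :
    ∃ M : Matrix (Fin 2 × S) (Fin 2 × S) ℤ, M.IsSymm ∧
      (∀ x, x ≠ 0 → m ≤ x ⬝ᵥ M *ᵥ x) ∧ IsPosDefForm (fromBlocks K 0 0 M) ∧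
      ∀ q ∈ S, Represents (fromBlocks K 0 0 M) q := by
  choose! N hsymm hmin hrep using hN
  let F : S → Matrix (Fin 2) (Fin 2) ℤ := fun q => N q
  have hF0 (q : S) (x : Fin 2 → ℤ) : 0 ≤ x ⬝ᵥ F q *ᵥ x := by
    by_cases hx : x = 0
    · simp [hx]
    · exact hm.le.trans (hmin q q.2 x hx)
  have hMs : (blockDiagonal F).IsSymm := by
    rw [IsSymm, blockDiagonal_transpose]
    congr 1
    ext1 q
    exact (hsymm q q.2).eq
  have hMm (x : Fin 2 × S → ℤ) (hx : x ≠ 0) : m ≤ x ⬝ᵥ blockDiagonal F *ᵥ x := by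
    rw [blockDiagonal_form]
    obtain ⟨⟨i, q⟩, hp⟩ := Function.ne_iff.1 hx
    have hxq : (fun i => x (i, q)) ≠ 0 := fun h => hp (congrFun h i)
    exact (hmin q q.2 _ hxq).trans
      (Finset.single_le_sum (f := fun q : S => (fun i => x (i, q)) ⬝ᵥ F q *ᵥ fun i => x (i, q))
        (fun q _ => hF0 q _) (Finset.mem_univ q))
  have hsum : (fromBlocks K 0 0 (blockDiagonal F)).IsSymm :=
    hK.1.fromBlocks (by simp) hMs
  refine ⟨blockDiagonal F, hMs, hMm, ⟨hsum, fun x hx => ?_⟩, fun q hq => ?_⟩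
  · rw [fromBlocks_form]
    by_cases h1 : x ∘ Sum.inl = 0
    · have h2 : x ∘ Sum.inr ≠ 0 := fun h2 => hx <| by
        ext i
        rcases i with i | i
        · exact congrFun h1 i
        · exact congrFun h2 i
      have := hMm _ h2
      rw [h1, zero_dotProduct]
      linarith
    · have h0 := hK.2 _ h1
      by_cases h2 : x ∘ Sum.inr = 0
      · rw [h2, zero_dotProduct]; linarith
      · linarith [hMm _ h2]
  · have hbin := (hS q hq).eq_bin
    have hq' := hS q hq
    have hr := hrep q hq
    rw [hbin] at hq' hr ⊢
    rw [represents_bin_iff (hK.1.fromBlocks (by simp) (by rw [← hbin]; exact hsymm q hq)) hq'] at hr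
    rw [represents_bin_iff hsum hq']
    obtain ⟨u, v, hu, huv, hv⟩ := hr
    rw [← hbin, fromBlocks_form] at hu huv hv
    have hk := form_of_support (N q) F ⟨q, hq⟩ rfl
    refine ⟨Sum.elim (u ∘ Sum.inl) fun p => if p.2 = ⟨q, hq⟩ then (u ∘ Sum.inr) p.1 else 0,
      Sum.elim (v ∘ Sum.inl) fun p => if p.2 = ⟨q, hq⟩ then (v ∘ Sum.inr) p.1 else 0, ?_, ?_, ?_⟩ <;>
    simpa only [fromBlocks_form, Sum.elim_comp_inl, Sum.elim_comp_inr, hk]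

/-- If a lattice `K` does not represent `ℓ = [a,b,c]`, whose coefficients are small compared with
`m`, while every other reduced form of minimum below `m` is obtained from vectors of `K` by possibly
adding to the second one an orthogonal vector of norm at least `m`, then every criterion set
contains `ℓ` up to equivalence. -/
theorem IsCriterionSet.exists_equivForm {K : Matrix ι ι ℤ} (hK : IsPosDefForm K) {m a b c : ℤ}
    (hpos : IsPosDefForm (bin a b c)) (ha : a < m) (hc : c < m ∨ c = m ∧ b ≠ 0)
    (havoid : ∀ u v : ι → ℤ, u ⬝ᵥ K *ᵥ u = a → v ⬝ᵥ K *ᵥ v = c → u ⬝ᵥ K *ᵥ v ≠ b)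
    (hrep : ∀ a' b' c' : ℤ, 0 < a' → 0 ≤ b' → 2 * b' ≤ a' → a' ≤ c' → a' < m →
      ¬ (a' = a ∧ b' = b ∧ c' = c) → ∃ u w : ι → ℤ, u ⬝ᵥ K *ᵥ u = a' ∧ u ⬝ᵥ K *ᵥ w = b' ∧
        (w ⬝ᵥ K *ᵥ w = c' ∨ w ⬝ᵥ K *ᵥ w + m ≤ c'))
    {S : Finset (Matrix (Fin 2) (Fin 2) ℤ)} (hS : IsCriterionSet S) :
    ∃ q' ∈ S, EquivForm (bin a b c) q' := by
  by_contra! hne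
  have hm : 0 < m := by
    have := hpos.2 ![1, 0] (by simp)
    rw [bin_form] at this
    simp at this
    linarith
  have hdiag {d : ℤ} (hd : m ≤ d) (x : Fin 2 → ℤ) (hx : x ≠ 0) : m ≤ x ⬝ᵥ bin m 0 d *ᵥ x :=
    le_bin_form le_rfl (by linarith) hd hx
  have hN : ∀ q ∈ S, ∃ N : Matrix (Fin 2) (Fin 2) ℤ, N.IsSymm ∧
      (∀ x : Fin 2 → ℤ, x ≠ 0 → m ≤ x ⬝ᵥ N *ᵥ x) ∧ Represents (fromBlocks K 0 0 N) q := by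
    intro q hq
    obtain ⟨a', b', c', ha', hb', hba, hac, he⟩ := exists_equivForm_reduced (hS.1 q hq)
    have hq' := (hS.1 q hq).equivForm he.symm
    have hsymm (d e f : ℤ) : (fromBlocks K 0 0 (bin d e f)).IsSymm :=
      hK.1.fromBlocks (by simp) (bin_isSymm d e f)
    rcases le_or_gt m a' with hma | hma
    · refine ⟨bin a' b' c', bin_isSymm _ _ _, fun x hx => hma.trans (le_bin_form hb' hba hac hx),
        Represents.equivForm hq' ((represents_bin_iff (hsymm _ _ _) hq').2
          ⟨Sum.elim 0 ![1, 0], Sum.elim 0 ![0, 1], ?_, ?_, ?_⟩) he⟩ <;>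
      simp [fromBlocks_form] <;> rfl
    · obtain ⟨u, w, hu, huw, hw⟩ := hrep a' b' c' ha' hb' hba hac hma <| by
        rintro ⟨rfl, rfl, rfl⟩
        exact hne q hq he
      rcases hw with hw | hw
      · refine ⟨bin m 0 m, bin_isSymm _ _ _, hdiag le_rfl,
          Represents.equivForm hq' ((represents_bin_iff (hsymm _ _ _) hq').2
            ⟨Sum.elim u 0, Sum.elim w 0, ?_, ?_, ?_⟩) he⟩ <;>
        simp [fromBlocks_form, hu, huw, hw]
      · refine ⟨bin m 0 (c' - w ⬝ᵥ K *ᵥ w), bin_isSymm _ _ _, hdiag (by linarith),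
          Represents.equivForm hq' ((represents_bin_iff (hsymm _ _ _) hq').2
            ⟨Sum.elim u 0, Sum.elim w ![0, 1], ?_, ?_, ?_⟩) he⟩ <;>
        simp only [fromBlocks_form, Sum.elim_comp_inl, Sum.elim_comp_inr, bin_form] <;>
        simp [hu, huw]
  obtain ⟨M, -, hMmin, hpd, hall⟩ := exists_common_orthogonal_sum hK hm hS.1 hN
  obtain ⟨u, v, hu, huv, hv⟩ :=
    (represents_bin_iff hpd.1 hpos).1 (hS.represents hpd hall hpos)
  rw [fromBlocks_form] at hu huv hv
  have hK0 (x : ι → ℤ) : 0 ≤ x ⬝ᵥ K *ᵥ x := by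
    by_cases hx : x = 0
    · simp [hx]
    · exact (hK.2 x hx).le
  have hur : u ∘ Sum.inr = 0 := by
    by_contra h
    linarith [hMmin _ h, hK0 (u ∘ Sum.inl)]
  rw [hur, zero_dotProduct, add_zero] at hu huv
  by_cases hvr : v ∘ Sum.inr = 0
  · rw [hvr, zero_dotProduct, add_zero] at hv
    exact havoid _ _ hu hv huv
  · have h1 := hMmin _ hvr
    have h2 := hK0 (v ∘ Sum.inl)
    rcases hc with hc | ⟨rfl, hb⟩
    · linarith
    · have hvl : v ∘ Sum.inl = 0 := by
        by_contra h
        linarith [hK.2 _ h]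
      rw [hvl, mulVec_zero, dotProduct_zero] at huv
      exact hb huv.symm

end Construction

theorem isPosDefForm_bin {a b c : ℤ} (ha : 0 < a) (hdet : 0 < a * c - b * b) :
    IsPosDefForm (bin a b c) := by
  refine ⟨bin_isSymm a b c, fun x hx => ?_⟩
  rw [bin_form]
  have key : 0 < (a * x 0 + b * x 1) ^ 2 + (a * c - b * b) * x 1 ^ 2 := by
    by_cases h1 : x 1 = 0
    · have h0 : x 0 ≠ 0 := fun h0 => hx (by ext i; fin_cases i <;> simp [h0, h1])
      rw [h1]
      have := sq_pos_of_ne_zero (mul_ne_zero ha.ne' h0)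
      simpa using this
    · have := mul_pos hdet (sq_pos_of_ne_zero h1)
      nlinarith [sq_nonneg (a * x 0 + b * x 1)]
  refine pos_of_mul_pos_right (a := a) ?_ ha.le
  linarith

theorem isPosDefForm_of_mul_self_le {ι : Type*} [Fintype ι] {G : Matrix ι ι ℤ} (hG : G.IsSymm)
    (h : ∀ (x : ι → ℤ) (i : ι), x i * x i ≤ x ⬝ᵥ G *ᵥ x) : IsPosDefForm G := by
  refine ⟨hG, fun x hx => ?_⟩
  obtain ⟨i, hi⟩ := Function.ne_iff.1 hx
  exact (mul_self_pos.2 hi).trans_le (h x i)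

theorem mem_Icc_of_mul_self_lt {x k : ℤ} (h : x * x < (k + 1) * (k + 1)) 
    (hk : 0 ≤ k := by norm_num) :
    x ∈ Finset.Icc (-k) k := by
  have := abs_lt_of_sq_lt_sq (by linarith : x ^ 2 < (k + 1) ^ 2) (by omega)
  rw [abs_lt] at this
  rw [Finset.mem_Icc]
  omega

section Lattices

variable {S : Finset (Matrix (Fin 2) (Fin 2) ℤ)}

theorem IsCriterionSet.exists_equivForm_one_zero_one (hS : IsCriterionSet S) :
    ∃ q' ∈ S, EquivForm (bin 1 0 1) q' := by
  have form (x y : Fin 1 → ℤ) : x ⬝ᵥ !![1] *ᵥ y =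
      x 0 * y 0 := by
    simp [mulVec, dotProduct]
  have hsq (x : Fin 1 → ℤ) (i : Fin 1) : x i * x i ≤ x ⬝ᵥ !![1] *ᵥ x := by
    rw [form]
    fin_cases i
    all_goals
      simp only [Fin.isValue, Fin.zero_eta]
      linarith only [mul_self_nonneg (x 0)]
  refine IsCriterionSet.exists_equivForm (K := !![1]) (m := 2)
    (isPosDefForm_of_mul_self_le (by decide) hsq) (isPosDefForm_bin (by norm_num) (by norm_num))
    (by norm_num) (by norm_num) (fun u v hu hv huv => ?_)
    (fun a b c ha hb hba hac ham hne => ?_) hS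
  · have hubd (i : Fin 1) := mem_Icc_of_mul_self_lt (k := 1)
      ((hsq u i).trans_lt (by rw [hu]; norm_num))
    have hvbd (i : Fin 1) := mem_Icc_of_mul_self_lt (k := 1)
      ((hsq v i).trans_lt (by rw [hv]; norm_num))
    rw [form] at hu hv huv
    let I := Finset.Icc (-1 : ℤ) 1
    have key : ∀ p ∈ I,
        p * p = 1 →
        ∀ q ∈ I,
        q * q = 1 →
        p * q ≠ 0 := by
      decide +kernel
    exact key (u 0) (hubd 0) hu
      (v 0) (hvbd 0) hv huv
  · simp only [form]
    obtain ⟨rfl, rfl⟩ : a = 1 ∧ b = 0 := by omega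
    have hc : 2 ≤ c := by omega
    exact ⟨![1], ![0], by decide, by decide, .inr (by simpa using hc)⟩

theorem IsCriterionSet.exists_equivForm_two_one_two (hS : IsCriterionSet S) :
    ∃ q' ∈ S, EquivForm (bin 2 1 2) q' := by
  have form (x y : Fin 3 → ℤ) : x ⬝ᵥ !![1, 0, 0; 0, 1, 0; 0, 0, 2] *ᵥ y =
      x 0 * y 0 + x 1 * y 1 + 2 * x 2 * y 2 := by
    simp [mulVec, dotProduct, Fin.sum_univ_succ]
    ring
  have hsq (x : Fin 3 → ℤ) (i : Fin 3) : x i * x i ≤ x ⬝ᵥ !![1, 0, 0; 0, 1, 0; 0, 0, 2] *ᵥ x := by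
    rw [form]
    fin_cases i
    all_goals
      simp only [Fin.zero_eta, Fin.mk_one, Fin.reduceFinMk]
      linarith only [mul_self_nonneg (x 0), mul_self_nonneg (x 1), mul_self_nonneg (x 2)]
  refine IsCriterionSet.exists_equivForm (K := !![1, 0, 0; 0, 1, 0; 0, 0, 2]) (m := 3)
    (isPosDefForm_of_mul_self_le (by decide) hsq) (isPosDefForm_bin (by norm_num) (by norm_num))
    (by norm_num) (by norm_num) (fun u v hu hv huv => ?_)
    (fun a b c ha hb hba hac ham hne => ?_) hS
  · have hubd (i : Fin 3) := mem_Icc_of_mul_self_lt (k := 1)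
      ((hsq u i).trans_lt (by rw [hu]; norm_num))
    have hvbd (i : Fin 3) := mem_Icc_of_mul_self_lt (k := 1)
      ((hsq v i).trans_lt (by rw [hv]; norm_num))
    rw [form] at hu hv huv
    let I := Finset.Icc (-1 : ℤ) 1
    have key : ∀ p ∈ I ×ˢ I ×ˢ I,
        p.1 * p.1 + p.2.1 * p.2.1 + 2 * p.2.2 * p.2.2 = 2 →
        ∀ q ∈ I ×ˢ I ×ˢ I,
        q.1 * q.1 + q.2.1 * q.2.1 + 2 * q.2.2 * q.2.2 = 2 →
        p.1 * q.1 + p.2.1 * q.2.1 + 2 * p.2.2 * q.2.2 ≠ 1 := by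
      decide +kernel
    exact key (u 0, u 1, u 2) (by simpa only [Finset.mem_product] using ⟨hubd 0, hubd 1, hubd 2⟩) hu
      (v 0, v 1, v 2) (by simpa only [Finset.mem_product] using ⟨hvbd 0, hvbd 1, hvbd 2⟩) hv huv
  · simp only [form]
    have hab : a = 1 ∧ b = 0 ∨ a = 2 ∧ b = 0 ∨ a = 2 ∧ b = 1 := by omega
    rcases hab with ⟨rfl, rfl⟩ | ⟨rfl, rfl⟩ | ⟨rfl, rfl⟩
    · obtain rfl | rfl | hc : c = 1 ∨ c = 2 ∨ 3 ≤ c := by omega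
      · exact ⟨![1, 0, 0], ![0, 1, 0], by decide, by decide, .inl (by decide)⟩
      · exact ⟨![1, 0, 0], ![0, 0, 1], by decide, by decide, .inl (by decide)⟩
      · exact ⟨![1, 0, 0], ![0, 0, 0], by decide, by decide, .inr (by simpa using hc)⟩
    · obtain rfl | hc : c = 2 ∨ 3 ≤ c := by omega
      · exact ⟨![1, 1, 0], ![0, 0, 1], by decide, by decide, .inl (by decide)⟩
      · exact ⟨![1, 1, 0], ![0, 0, 0], by decide, by decide, .inr (by simpa using hc)⟩
    · obtain rfl | hc : c = 3 ∨ 4 ≤ c := by omega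
      · exact ⟨![1, 1, 0], ![1, 0, 1], by decide, by decide, .inl (by decide)⟩
      · exact ⟨![1, 1, 0], ![1, 0, 0], by decide, by decide, .inr (by simpa using hc)⟩

theorem IsCriterionSet.exists_equivForm_two_one_three (hS : IsCriterionSet S) :
    ∃ q' ∈ S, EquivForm (bin 2 1 3) q' := by
  have form (x y : Fin 3 → ℤ) : x ⬝ᵥ !![1, 0, 0; 0, 1, 0; 0, 0, 1] *ᵥ y =
      x 0 * y 0 + x 1 * y 1 + x 2 * y 2 := by
    simp [mulVec, dotProduct, Fin.sum_univ_succ]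
    ring
  have hsq (x : Fin 3 → ℤ) (i : Fin 3) : x i * x i ≤ x ⬝ᵥ !![1, 0, 0; 0, 1, 0; 0, 0, 1] *ᵥ x := by
    rw [form]
    fin_cases i
    all_goals
      simp only [Fin.zero_eta, Fin.mk_one, Fin.reduceFinMk]
      linarith only [mul_self_nonneg (x 0), mul_self_nonneg (x 1), mul_self_nonneg (x 2)]
  refine IsCriterionSet.exists_equivForm (K := !![1, 0, 0; 0, 1, 0; 0, 0, 1]) (m := 3)
    (isPosDefForm_of_mul_self_le (by decide) hsq) (isPosDefForm_bin (by norm_num) (by norm_num))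
    (by norm_num) (by norm_num) (fun u v hu hv huv => ?_)
    (fun a b c ha hb hba hac ham hne => ?_) hS
  · have hubd (i : Fin 3) := mem_Icc_of_mul_self_lt (k := 1)
      ((hsq u i).trans_lt (by rw [hu]; norm_num))
    have hvbd (i : Fin 3) := mem_Icc_of_mul_self_lt (k := 1)
      ((hsq v i).trans_lt (by rw [hv]; norm_num))
    rw [form] at hu hv huv
    let I := Finset.Icc (-1 : ℤ) 1
    have key : ∀ p ∈ I ×ˢ I ×ˢ I,
        p.1 * p.1 + p.2.1 * p.2.1 + p.2.2 * p.2.2 = 2 →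
        ∀ q ∈ I ×ˢ I ×ˢ I,
        q.1 * q.1 + q.2.1 * q.2.1 + q.2.2 * q.2.2 = 3 →
        p.1 * q.1 + p.2.1 * q.2.1 + p.2.2 * q.2.2 ≠ 1 := by
      decide +kernel
    exact key (u 0, u 1, u 2) (by simpa only [Finset.mem_product] using ⟨hubd 0, hubd 1, hubd 2⟩) hu
      (v 0, v 1, v 2) (by simpa only [Finset.mem_product] using ⟨hvbd 0, hvbd 1, hvbd 2⟩) hv huv
  · simp only [form]
    have hab : a = 1 ∧ b = 0 ∨ a = 2 ∧ b = 0 ∨ a = 2 ∧ b = 1 := by omega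
    rcases hab with ⟨rfl, rfl⟩ | ⟨rfl, rfl⟩ | ⟨rfl, rfl⟩
    · obtain rfl | rfl | hc : c = 1 ∨ c = 2 ∨ 3 ≤ c := by omega
      · exact ⟨![1, 0, 0], ![0, 1, 0], by decide, by decide, .inl (by decide)⟩
      · exact ⟨![1, 0, 0], ![0, 1, 1], by decide, by decide, .inl (by decide)⟩
      · exact ⟨![1, 0, 0], ![0, 0, 0], by decide, by decide, .inr (by simpa using hc)⟩
    · obtain rfl | hc : c = 2 ∨ 3 ≤ c := by omega
      · exact ⟨![1, 1, 0], ![1, -1, 0], by decide, by decide, .inl (by decide)⟩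
      · exact ⟨![1, 1, 0], ![0, 0, 0], by decide, by decide, .inr (by simpa using hc)⟩
    · obtain rfl | hc : c = 2 ∨ 4 ≤ c := by omega
      · exact ⟨![1, 1, 0], ![1, 0, 1], by decide, by decide, .inl (by decide)⟩
      · exact ⟨![1, 1, 0], ![1, 0, 0], by decide, by decide, .inr (by simpa using hc)⟩

theorem IsCriterionSet.exists_equivForm_two_one_four (hS : IsCriterionSet S) :
    ∃ q' ∈ S, EquivForm (bin 2 1 4) q' := by
  have form (x y : Fin 4 → ℤ) : x ⬝ᵥ !![1, 0, 0, 0; 0, 1, 0, 0; 0, 0, 1, 0; 0, 0, 0, 1] *ᵥ y =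
      x 0 * y 0 + x 1 * y 1 + x 2 * y 2 + x 3 * y 3 := by
    simp [mulVec, dotProduct, Fin.sum_univ_succ]
    ring
  have hsq (x : Fin 4 → ℤ) (i : Fin 4) : x i * x i ≤ x ⬝ᵥ !![1, 0, 0, 0; 0, 1, 0, 0; 0, 0, 1, 0; 0, 0, 0, 1] *ᵥ x := by
    rw [form]
    fin_cases i
    all_goals
      simp only [Fin.zero_eta, Fin.mk_one, Fin.reduceFinMk]
      linarith only [mul_self_nonneg (x 0), mul_self_nonneg (x 1), mul_self_nonneg (x 2), mul_self_nonneg (x 3)]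
  refine IsCriterionSet.exists_equivForm (K := !![1, 0, 0, 0; 0, 1, 0, 0; 0, 0, 1, 0; 0, 0, 0, 1]) (m := 4)
    (isPosDefForm_of_mul_self_le (by decide) hsq) (isPosDefForm_bin (by norm_num) (by norm_num))
    (by norm_num) (by norm_num) (fun u v hu hv huv => ?_)
    (fun a b c ha hb hba hac ham hne => ?_) hS
  · have hubd (i : Fin 4) := mem_Icc_of_mul_self_lt (k := 1)
      ((hsq u i).trans_lt (by rw [hu]; norm_num))
    have hvbd (i : Fin 4) := mem_Icc_of_mul_self_lt (k := 2)
      ((hsq v i).trans_lt (by rw [hv]; norm_num))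
    rw [form] at hu hv huv
    let I := Finset.Icc (-1 : ℤ) 1
    let J := Finset.Icc (-2 : ℤ) 2
    have key : ∀ p ∈ I ×ˢ I ×ˢ I ×ˢ I,
        p.1 * p.1 + p.2.1 * p.2.1 + p.2.2.1 * p.2.2.1 + p.2.2.2 * p.2.2.2 = 2 →
        ∀ q ∈ J ×ˢ J ×ˢ J ×ˢ J,
        q.1 * q.1 + q.2.1 * q.2.1 + q.2.2.1 * q.2.2.1 + q.2.2.2 * q.2.2.2 = 4 →
        p.1 * q.1 + p.2.1 * q.2.1 + p.2.2.1 * q.2.2.1 + p.2.2.2 * q.2.2.2 ≠ 1 := by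
      decide +kernel
    exact key (u 0, u 1, u 2, u 3) (by simpa only [Finset.mem_product] using ⟨hubd 0, hubd 1, hubd 2, hubd 3⟩) hu
      (v 0, v 1, v 2, v 3) (by simpa only [Finset.mem_product] using ⟨hvbd 0, hvbd 1, hvbd 2, hvbd 3⟩) hv huv
  · simp only [form]
    have hab : a = 1 ∧ b = 0 ∨ a = 2 ∧ b = 0 ∨ a = 2 ∧ b = 1 ∨ a = 3 ∧ b = 0 ∨ a = 3 ∧ b = 1 := by omega
    rcases hab with ⟨rfl, rfl⟩ | ⟨rfl, rfl⟩ | ⟨rfl, rfl⟩ | ⟨rfl, rfl⟩ | ⟨rfl, rfl⟩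
    · obtain rfl | rfl | rfl | hc : c = 1 ∨ c = 2 ∨ c = 3 ∨ 4 ≤ c := by omega
      · exact ⟨![1, 0, 0, 0], ![0, 1, 0, 0], by decide, by decide, .inl (by decide)⟩
      · exact ⟨![1, 0, 0, 0], ![0, 1, 1, 0], by decide, by decide, .inl (by decide)⟩
      · exact ⟨![1, 0, 0, 0], ![0, 1, 1, 1], by decide, by decide, .inl (by decide)⟩
      · exact ⟨![1, 0, 0, 0], ![0, 0, 0, 0], by decide, by decide, .inr (by simpa using hc)⟩
    · obtain rfl | rfl | hc : c = 2 ∨ c = 3 ∨ 4 ≤ c := by omega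
      · exact ⟨![1, 1, 0, 0], ![1, -1, 0, 0], by decide, by decide, .inl (by decide)⟩
      · exact ⟨![1, 1, 0, 0], ![1, -1, 1, 0], by decide, by decide, .inl (by decide)⟩
      · exact ⟨![1, 1, 0, 0], ![0, 0, 0, 0], by decide, by decide, .inr (by simpa using hc)⟩
    · obtain rfl | rfl | hc : c = 2 ∨ c = 3 ∨ 5 ≤ c := by omega
      · exact ⟨![1, 1, 0, 0], ![1, 0, 1, 0], by decide, by decide, .inl (by decide)⟩
      · exact ⟨![1, 1, 0, 0], ![1, 0, 1, 1], by decide, by decide, .inl (by decide)⟩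
      · exact ⟨![1, 1, 0, 0], ![1, 0, 0, 0], by decide, by decide, .inr (by simpa using hc)⟩
    · obtain rfl | hc : c = 3 ∨ 4 ≤ c := by omega
      · exact ⟨![1, 1, 1, 0], ![1, -1, 0, 1], by decide, by decide, .inl (by decide)⟩
      · exact ⟨![1, 1, 1, 0], ![0, 0, 0, 0], by decide, by decide, .inr (by simpa using hc)⟩
    · obtain rfl | rfl | hc : c = 3 ∨ c = 4 ∨ 5 ≤ c := by omega
      · exact ⟨![1, 1, 1, 0], ![1, 1, -1, 0], by decide, by decide, .inl (by decide)⟩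
      · exact ⟨![1, 1, 1, 0], ![1, 1, -1, 1], by decide, by decide, .inl (by decide)⟩
      · exact ⟨![1, 1, 1, 0], ![1, 0, 0, 0], by decide, by decide, .inr (by simpa using hc)⟩

theorem IsCriterionSet.exists_equivForm_two_zero_three (hS : IsCriterionSet S) :
    ∃ q' ∈ S, EquivForm (bin 2 0 3) q' := by
  have form (x y : Fin 4 → ℤ) : x ⬝ᵥ !![1, 0, 0, 0; 0, 1, 0, 0; 0, 0, 2, 1; 0, 0, 1, 2] *ᵥ y =
      x 0 * y 0 + x 1 * y 1 + 2 * x 2 * y 2 + x 2 * y 3 + x 3 * y 2 + 2 * x 3 * y 3 := by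
    simp [mulVec, dotProduct, Fin.sum_univ_succ]
    ring
  have hsq (x : Fin 4 → ℤ) (i : Fin 4) : x i * x i ≤ x ⬝ᵥ !![1, 0, 0, 0; 0, 1, 0, 0; 0, 0, 2, 1; 0, 0, 1, 2] *ᵥ x := by
    rw [form]
    fin_cases i
    all_goals
      simp only [Fin.zero_eta, Fin.mk_one, Fin.reduceFinMk]
      linarith only [mul_self_nonneg (x 0), mul_self_nonneg (x 1), mul_self_nonneg (x 2), mul_self_nonneg (x 3), mul_self_nonneg (x 2 + x 3)]
  refine IsCriterionSet.exists_equivForm (K := !![1, 0, 0, 0; 0, 1, 0, 0; 0, 0, 2, 1; 0, 0, 1, 2]) (m := 4)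
    (isPosDefForm_of_mul_self_le (by decide) hsq) (isPosDefForm_bin (by norm_num) (by norm_num))
    (by norm_num) (by norm_num) (fun u v hu hv huv => ?_)
    (fun a b c ha hb hba hac ham hne => ?_) hS
  · have hubd (i : Fin 4) := mem_Icc_of_mul_self_lt (k := 1)
      ((hsq u i).trans_lt (by rw [hu]; norm_num))
    have hvbd (i : Fin 4) := mem_Icc_of_mul_self_lt (k := 1)
      ((hsq v i).trans_lt (by rw [hv]; norm_num))
    rw [form] at hu hv huv
    let I := Finset.Icc (-1 : ℤ) 1
    have key : ∀ p ∈ I ×ˢ I ×ˢ I ×ˢ I,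
        p.1 * p.1 + p.2.1 * p.2.1 + 2 * p.2.2.1 * p.2.2.1 + p.2.2.1 * p.2.2.2 + p.2.2.2 * p.2.2.1 + 2 * p.2.2.2 * p.2.2.2 = 2 →
        ∀ q ∈ I ×ˢ I ×ˢ I ×ˢ I,
        q.1 * q.1 + q.2.1 * q.2.1 + 2 * q.2.2.1 * q.2.2.1 + q.2.2.1 * q.2.2.2 + q.2.2.2 * q.2.2.1 + 2 * q.2.2.2 * q.2.2.2 = 3 →
        p.1 * q.1 + p.2.1 * q.2.1 + 2 * p.2.2.1 * q.2.2.1 + p.2.2.1 * q.2.2.2 + p.2.2.2 * q.2.2.1 + 2 * p.2.2.2 * q.2.2.2 ≠ 0 := by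
      decide +kernel
    exact key (u 0, u 1, u 2, u 3) (by simpa only [Finset.mem_product] using ⟨hubd 0, hubd 1, hubd 2, hubd 3⟩) hu
      (v 0, v 1, v 2, v 3) (by simpa only [Finset.mem_product] using ⟨hvbd 0, hvbd 1, hvbd 2, hvbd 3⟩) hv huv
  · simp only [form]
    have hab : a = 1 ∧ b = 0 ∨ a = 2 ∧ b = 0 ∨ a = 2 ∧ b = 1 ∨ a = 3 ∧ b = 0 ∨ a = 3 ∧ b = 1 := by omega
    rcases hab with ⟨rfl, rfl⟩ | ⟨rfl, rfl⟩ | ⟨rfl, rfl⟩ | ⟨rfl, rfl⟩ | ⟨rfl, rfl⟩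
    · obtain rfl | rfl | rfl | hc : c = 1 ∨ c = 2 ∨ c = 3 ∨ 4 ≤ c := by omega
      · exact ⟨![1, 0, 0, 0], ![0, 1, 0, 0], by decide, by decide, .inl (by decide)⟩
      · exact ⟨![1, 0, 0, 0], ![0, 0, 1, 0], by decide, by decide, .inl (by decide)⟩
      · exact ⟨![1, 0, 0, 0], ![0, 1, 1, 0], by decide, by decide, .inl (by decide)⟩
      · exact ⟨![1, 0, 0, 0], ![0, 0, 0, 0], by decide, by decide, .inr (by simpa using hc)⟩
    · obtain rfl | hc : c = 2 ∨ 4 ≤ c := by omega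
      · exact ⟨![1, 1, 0, 0], ![0, 0, 1, 0], by decide, by decide, .inl (by decide)⟩
      · exact ⟨![1, 1, 0, 0], ![0, 0, 0, 0], by decide, by decide, .inr (by simpa using hc)⟩
    · obtain rfl | rfl | rfl | hc : c = 2 ∨ c = 3 ∨ c = 4 ∨ 5 ≤ c := by omega
      · exact ⟨![0, 0, 1, 0], ![0, 0, 0, 1], by decide, by decide, .inl (by decide)⟩
      · exact ⟨![0, 0, 1, 0], ![1, 0, 0, 1], by decide, by decide, .inl (by decide)⟩
      · exact ⟨![0, 0, 1, 0], ![1, 1, 0, 1], by decide, by decide, .inl (by decide)⟩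
      · exact ⟨![1, 1, 0, 0], ![1, 0, 0, 0], by decide, by decide, .inr (by simpa using hc)⟩
    · obtain rfl | hc : c = 3 ∨ 4 ≤ c := by omega
      · exact ⟨![1, 0, 1, 0], ![1, 0, 0, -1], by decide, by decide, .inl (by decide)⟩
      · exact ⟨![1, 0, 1, 0], ![0, 0, 0, 0], by decide, by decide, .inr (by simpa using hc)⟩
    · obtain rfl | rfl | hc : c = 3 ∨ c = 4 ∨ 5 ≤ c := by omega
      · exact ⟨![1, 0, 1, 0], ![0, 1, 0, 1], by decide, by decide, .inl (by decide)⟩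
      · exact ⟨![1, 0, 1, 0], ![-1, 1, 1, 0], by decide, by decide, .inl (by decide)⟩
      · exact ⟨![1, 0, 1, 0], ![1, 0, 0, 0], by decide, by decide, .inr (by simpa using hc)⟩

theorem IsCriterionSet.exists_equivForm_three_zero_three (hS : IsCriterionSet S) :
    ∃ q' ∈ S, EquivForm (bin 3 0 3) q' := by
  have form (x y : Fin 4 → ℤ) : x ⬝ᵥ !![1, 0, 0, 0; 0, 1, 0, 0; 0, 0, 1, 0; 0, 0, 0, 2] *ᵥ y =
      x 0 * y 0 + x 1 * y 1 + x 2 * y 2 + 2 * x 3 * y 3 := by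
    simp [mulVec, dotProduct, Fin.sum_univ_succ]
    ring
  have hsq (x : Fin 4 → ℤ) (i : Fin 4) : x i * x i ≤ x ⬝ᵥ !![1, 0, 0, 0; 0, 1, 0, 0; 0, 0, 1, 0; 0, 0, 0, 2] *ᵥ x := by
    rw [form]
    fin_cases i
    all_goals
      simp only [Fin.zero_eta, Fin.mk_one, Fin.reduceFinMk]
      linarith only [mul_self_nonneg (x 0), mul_self_nonneg (x 1), mul_self_nonneg (x 2), mul_self_nonneg (x 3)]
  refine IsCriterionSet.exists_equivForm (K := !![1, 0, 0, 0; 0, 1, 0, 0; 0, 0, 1, 0; 0, 0, 0, 2]) (m := 4)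
    (isPosDefForm_of_mul_self_le (by decide) hsq) (isPosDefForm_bin (by norm_num) (by norm_num))
    (by norm_num) (by norm_num) (fun u v hu hv huv => ?_)
    (fun a b c ha hb hba hac ham hne => ?_) hS
  · have hubd (i : Fin 4) := mem_Icc_of_mul_self_lt (k := 1)
      ((hsq u i).trans_lt (by rw [hu]; norm_num))
    have hvbd (i : Fin 4) := mem_Icc_of_mul_self_lt (k := 1)
      ((hsq v i).trans_lt (by rw [hv]; norm_num))
    rw [form] at hu hv huv
    let I := Finset.Icc (-1 : ℤ) 1
    have key : ∀ p ∈ I ×ˢ I ×ˢ I ×ˢ I,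
        p.1 * p.1 + p.2.1 * p.2.1 + p.2.2.1 * p.2.2.1 + 2 * p.2.2.2 * p.2.2.2 = 3 →
        ∀ q ∈ I ×ˢ I ×ˢ I ×ˢ I,
        q.1 * q.1 + q.2.1 * q.2.1 + q.2.2.1 * q.2.2.1 + 2 * q.2.2.2 * q.2.2.2 = 3 →
        p.1 * q.1 + p.2.1 * q.2.1 + p.2.2.1 * q.2.2.1 + 2 * p.2.2.2 * q.2.2.2 ≠ 0 := by
      decide +kernel
    exact key (u 0, u 1, u 2, u 3) (by simpa only [Finset.mem_product] using ⟨hubd 0, hubd 1, hubd 2, hubd 3⟩) hu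
      (v 0, v 1, v 2, v 3) (by simpa only [Finset.mem_product] using ⟨hvbd 0, hvbd 1, hvbd 2, hvbd 3⟩) hv huv
  · simp only [form]
    have hab : a = 1 ∧ b = 0 ∨ a = 2 ∧ b = 0 ∨ a = 2 ∧ b = 1 ∨ a = 3 ∧ b = 0 ∨ a = 3 ∧ b = 1 := by omega
    rcases hab with ⟨rfl, rfl⟩ | ⟨rfl, rfl⟩ | ⟨rfl, rfl⟩ | ⟨rfl, rfl⟩ | ⟨rfl, rfl⟩
    · obtain rfl | rfl | rfl | hc : c = 1 ∨ c = 2 ∨ c = 3 ∨ 4 ≤ c := by omega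
      · exact ⟨![1, 0, 0, 0], ![0, 1, 0, 0], by decide, by decide, .inl (by decide)⟩
      · exact ⟨![1, 0, 0, 0], ![0, 1, 1, 0], by decide, by decide, .inl (by decide)⟩
      · exact ⟨![1, 0, 0, 0], ![0, 1, 0, 1], by decide, by decide, .inl (by decide)⟩
      · exact ⟨![1, 0, 0, 0], ![0, 0, 0, 0], by decide, by decide, .inr (by simpa using hc)⟩
    · obtain rfl | rfl | hc : c = 2 ∨ c = 3 ∨ 4 ≤ c := by omega
      · exact ⟨![1, 1, 0, 0], ![1, -1, 0, 0], by decide, by decide, .inl (by decide)⟩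
      · exact ⟨![1, 1, 0, 0], ![1, -1, 1, 0], by decide, by decide, .inl (by decide)⟩
      · exact ⟨![1, 1, 0, 0], ![0, 0, 0, 0], by decide, by decide, .inr (by simpa using hc)⟩
    · obtain rfl | rfl | rfl | hc : c = 2 ∨ c = 3 ∨ c = 4 ∨ 5 ≤ c := by omega
      · exact ⟨![1, 1, 0, 0], ![1, 0, 1, 0], by decide, by decide, .inl (by decide)⟩
      · exact ⟨![1, 1, 0, 0], ![1, 0, 0, 1], by decide, by decide, .inl (by decide)⟩
      · exact ⟨![1, 1, 0, 0], ![1, 0, 1, 1], by decide, by decide, .inl (by decide)⟩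
      · exact ⟨![1, 1, 0, 0], ![1, 0, 0, 0], by decide, by decide, .inr (by simpa using hc)⟩
    · have hc : 4 ≤ c := by omega
      exact ⟨![1, 0, 0, 1], ![0, 0, 0, 0], by decide, by decide, .inr (by simpa using hc)⟩
    · obtain rfl | rfl | hc : c = 3 ∨ c = 4 ∨ 5 ≤ c := by omega
      · exact ⟨![1, 1, 1, 0], ![1, 1, -1, 0], by decide, by decide, .inl (by decide)⟩
      · exact ⟨![1, 0, 0, 1], ![-1, 1, 0, 1], by decide, by decide, .inl (by decide)⟩
      · exact ⟨![1, 0, 0, 1], ![1, 0, 0, 0], by decide, by decide, .inr (by simpa using hc)⟩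

end Lattices

/-- assuming the Kim–Kim–Oh theorem that
`𝒮₂ = {⟨1,1⟩, ⟨2,3⟩, ⟨3,3⟩, [2,1,2], [2,1,3], [2,1,4]}` is a 2-criterion set, every
2-criterion set contains all six forms of `𝒮₂` up to equivalence. -/
theorem unique_minimal_criterion_set
    (hKKO : IsCriterionSet {bin 1 0 1, bin 2 0 3, bin 3 0 3, bin 2 1 2, bin 2 1 3, bin 2 1 4})
    (S : Finset (Matrix (Fin 2) (Fin 2) ℤ)) (hS : IsCriterionSet S) :
    ∀ q ∈ ({bin 1 0 1, bin 2 0 3, bin 3 0 3, bin 2 1 2, bin 2 1 3, bin 2 1 4} :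
        Finset (Matrix (Fin 2) (Fin 2) ℤ)),
      ∃ q' ∈ S, EquivForm q q' := by
  intro q hq
  simp only [Finset.mem_insert, Finset.mem_singleton] at hq
  rcases hq with rfl | rfl | rfl | rfl | rfl | rfl
  · exact hS.exists_equivForm_one_zero_one
  · exact hS.exists_equivForm_two_zero_three
  · exact hS.exists_equivForm_three_zero_three
  · exact hS.exists_equivForm_two_one_two
  · exact hS.exists_equivForm_two_one_three
  · exact hS.exists_equivForm_two_one_four
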